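/- arXiv:0810.4826 — 2 statements merged into one kernel-verified Lean document; each statement's English description precedes it below -/
import Mathlib

section
/- Let I be the augmentation ideal of the integral group algebra ℤ[ℚ/ℤ]. Then for every integer k ≥ 2 one has I^k = I^{k+1}; consequently I^k = I² for all k ≥ 2. -/
noncomputable section

/-- The group `ℚ/ℤ`. -/
abbrev QZ : Type := AddCircle (1 : ℚ)

/-- The integral group algebra `ℤ[ℚ/ℤ]`. -/
abbrev RZ : Type := AddMonoidAlgebra ℤ QZ

/-- The augmentation ring homomorphism `ℤ[ℚ/ℤ] → ℤ`, sending every group element to `1`. -/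
def eps : RZ →+* ℤ :=
  AddMonoidAlgebra.liftNCRingHom (RingHom.id ℤ) 1 (fun _ _ => Commute.one_right _)

/-- The augmentation ideal `I = ker ε`. -/
def Iaug : Ideal RZ := RingHom.ker eps

/-- The element `[a] - 1` of the group algebra. -/
def augGen (a : QZ) : RZ := AddMonoidAlgebra.single a 1 - 1

theorem eps_single (a : QZ) (m : ℤ) : eps (AddMonoidAlgebra.single a m) = m := by
  simp [eps, AddMonoidAlgebra.liftNCRingHom]

theorem augGen_mem (a : QZ) : augGen a ∈ Iaug := by
  rw [Iaug, RingHom.mem_ker, augGen, map_sub, eps_single, map_one, sub_self]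

theorem sub_eps_mem_span (f : RZ) :
    f - ((eps f : ℤ) : RZ) ∈ Ideal.span (Set.range augGen) := by
  induction f using AddMonoidAlgebra.induction_linear with
  | zero => simp
  | add f g hf hg =>
    have h := add_mem hf hg
    rw [map_add, Int.cast_add]
    convert h using 1
    ring
  | single a m =>
    rw [eps_single]
    have h : AddMonoidAlgebra.single a m - (m : RZ) = (m : RZ) * augGen a := by
      rw [augGen, mul_sub, mul_one, ← zsmul_eq_mul, AddMonoidAlgebra.smul_single]
      simp
    rw [h]
    exact Ideal.mul_mem_left _ _ (Ideal.subset_span ⟨a, rfl⟩)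

theorem Iaug_eq_span : Iaug = Ideal.span (Set.range augGen) := by
  apply le_antisymm
  · intro f hf
    have h := sub_eps_mem_span f
    rwa [RingHom.mem_ker.mp hf, Int.cast_zero, sub_zero] at h
  · rw [Ideal.span_le]
    rintro _ ⟨a, rfl⟩
    exact augGen_mem a

theorem augGen_zero : augGen 0 = 0 := by
  rw [augGen, ← AddMonoidAlgebra.one_def, sub_self]

theorem augGen_add (a b : QZ) :
    augGen (a + b) = augGen a + augGen b + augGen a * augGen b := by
  have h : (AddMonoidAlgebra.single (a + b) 1 : RZ) =
      AddMonoidAlgebra.single a 1 * AddMonoidAlgebra.single b 1 := by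
    rw [AddMonoidAlgebra.single_mul_single, one_mul]
  rw [augGen, augGen, augGen, h]
  ring

theorem augGen_nsmul_sub_mem (n : ℕ) (a : QZ) :
    augGen (n • a) - (n : RZ) * augGen a ∈ Iaug ^ 2 := by
  induction n with
  | zero => simp [augGen_zero]
  | succ n ih =>
    have h : augGen (n • a) * augGen a ∈ Iaug ^ 2 := by
      rw [pow_two]
      exact Ideal.mul_mem_mul (augGen_mem _) (augGen_mem _)
    rw [succ_nsmul, augGen_add]
    convert add_mem ih h using 1
    push_cast
    ring

theorem exists_nsmul_eq_zero_and_nsmul_eq (a b : QZ) :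
    ∃ (n : ℕ) (c : QZ), n • b = 0 ∧ n • c = a := by
  obtain ⟨r, rfl⟩ := QuotientAddGroup.mk_surjective a
  obtain ⟨q, rfl⟩ := QuotientAddGroup.mk_surjective b
  refine ⟨q.den, ((r / q.den : ℚ) : QZ), ?_, ?_⟩
  · change ((q.den • q : ℚ) : QZ) = 0
    rw [AddCircle.coe_eq_zero_iff]
    exact ⟨q.num, by simp [Rat.den_mul_eq_num]⟩
  · change ((q.den • (r / q.den) : ℚ) : QZ) = (r : QZ)
    have hq : (q.den : ℚ) ≠ 0 := Nat.cast_ne_zero.mpr q.den_nz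
    rw [nsmul_eq_mul, mul_div_cancel₀ _ hq]

theorem augGen_mul_augGen_mem (a b : QZ) : augGen a * augGen b ∈ Iaug ^ 3 := by
  obtain ⟨n, c, hb, rfl⟩ := exists_nsmul_eq_zero_and_nsmul_eq a b
  have h₁ := Ideal.mul_mem_mul (augGen_nsmul_sub_mem n c) (augGen_mem b)
  have h₂ := Ideal.mul_mem_mul (augGen_nsmul_sub_mem n b) (augGen_mem c)
  rw [hb, augGen_zero] at h₂
  rw [← pow_succ] at h₁ h₂
  convert sub_mem h₁ h₂ using 1
  ring

theorem Iaug_sq_eq_cube : Iaug ^ 2 = Iaug ^ 3 := by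
  apply le_antisymm
  · conv_lhs => rw [pow_two, Iaug_eq_span, Ideal.span_mul_span']
    rw [Ideal.span_le]
    rintro _ ⟨_, ⟨a, rfl⟩, _, ⟨b, rfl⟩, rfl⟩
    exact augGen_mul_augGen_mem a b
  · exact Ideal.pow_le_pow_right (by norm_num)

/-- For `k ≥ 2`, `I^k = I^{k+1}`; consequently `I^k = I²` for all `k ≥ 2`. -/
theorem augmentation_ideal_pow_stable :
    (∀ k : ℕ, 2 ≤ k → Iaug ^ k = Iaug ^ (k + 1)) ∧
    (∀ k : ℕ, 2 ≤ k → Iaug ^ k = Iaug ^ 2) := by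
  have h : ∀ k : ℕ, 2 ≤ k → Iaug ^ k = Iaug ^ 2 := by
    intro k hk
    induction k, hk using Nat.le_induction with
    | base => rfl
    | succ k _ ih => rw [pow_succ, ih, ← pow_succ, Iaug_sq_eq_cube]
  exact ⟨fun k hk => (h k hk).trans (h (k + 1) (by omega)).symm, h⟩
end
end

section
/- Let l be a prime and let H be the integral Heisenberg group, i.e., the group of 3×3 upper triangular integer matrices with all diagonal entries equal to 1, under matrix multiplication. Let K ≤ H be the subset of those matrices whose (1,2)-entry is divisible by l. Then K is a subgroup of index l in H, and the abelianization K/[K,K] is not torsion-free: it contains a nontrivial element of order dividing l (namely the class of the elementary matrix with (1,3)-entry 1). -/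
/-- The integral Heisenberg group: matrices `[[1,a,b],[0,1,c],[0,0,1]]` with
`a, b, c ∈ ℤ`, recorded by their strictly-upper-triangular entries.
Here `a` is the `(1,2)`-entry, `b` the `(1,3)`-entry and `c` the `(2,3)`-entry. -/
@[ext]
structure Heis where
  a : ℤ
  b : ℤ
  c : ℤ

namespace Heis

/-- Matrix multiplication of the corresponding unitriangular matrices. -/
instance : Mul Heis := ⟨fun x y => ⟨x.a + y.a, x.b + y.b + x.a * y.c, x.c + y.c⟩⟩
instance : One Heis := ⟨⟨0, 0, 0⟩⟩
instance : Inv Heis := ⟨fun x => ⟨-x.a, -x.b + x.a * x.c, -x.c⟩⟩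

@[simp] lemma mul_a (x y : Heis) : (x * y).a = x.a + y.a := rfl
@[simp] lemma mul_b (x y : Heis) : (x * y).b = x.b + y.b + x.a * y.c := rfl
@[simp] lemma mul_c (x y : Heis) : (x * y).c = x.c + y.c := rfl
@[simp] lemma one_a : (1 : Heis).a = 0 := rfl
@[simp] lemma one_b : (1 : Heis).b = 0 := rfl
@[simp] lemma one_c : (1 : Heis).c = 0 := rfl
@[simp] lemma inv_a (x : Heis) : (x⁻¹).a = -x.a := rfl
@[simp] lemma inv_b (x : Heis) : (x⁻¹).b = -x.b + x.a * x.c := rfl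
@[simp] lemma inv_c (x : Heis) : (x⁻¹).c = -x.c := rfl

instance : Group Heis where
  mul_assoc x y z := by ext <;> (simp; try ring)
  one_mul x := by ext <;> simp
  mul_one x := by ext <;> simp
  inv_mul_cancel x := by ext <;> (simp; try ring)

end Heis

/-- The subgroup of the integral Heisenberg group consisting of matrices whose
`(1,2)`-entry is divisible by `l`. -/
def Klev (l : ℕ) : Subgroup Heis where
  carrier := { x | (l : ℤ) ∣ x.a }
  one_mem' := by simp
  mul_mem' := fun hx hy => by simpa using dvd_add hx hy
  inv_mem' := fun hx => by simpa using hx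

/-- The element of `Klev l` given by the elementary matrix with `(1,3)`-entry `1`. -/
def e13 (l : ℕ) : Klev l := ⟨⟨0, 1, 0⟩, dvd_zero _⟩

/-- Reduction modulo `l` of the `(1,2)`-entry. -/
def Heis.aMod (l : ℕ) : Heis →* Multiplicative (ZMod l) where
  toFun x := Multiplicative.ofAdd (x.a : ZMod l)
  map_one' := by simp
  map_mul' x y := by simp [ofAdd_add]

lemma Heis.aMod_surjective (l : ℕ) : Function.Surjective (Heis.aMod l) := fun z => by
  obtain ⟨n, hn⟩ := ZMod.intCast_surjective z.toAdd
  exact ⟨⟨n, 0, 0⟩, congrArg Multiplicative.ofAdd hn⟩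

lemma Heis.ker_aMod (l : ℕ) : (Heis.aMod l).ker = Klev l :=
  Subgroup.ext fun x => ZMod.intCast_zmod_eq_zero_iff_dvd x.a l

lemma index_Klev (l : ℕ) : (Klev l).index = l := by
  rw [← Heis.ker_aMod, Subgroup.index_ker, MonoidHom.range_eq_top.2 (Heis.aMod_surjective l),
    Subgroup.card_top]
  exact Nat.card_zmod l

/-- Reduction modulo `l` of the `(1,3)`-entry, which is multiplicative on `Klev l`. -/
def Klev.bMod (l : ℕ) : Klev l →* Multiplicative (ZMod l) where
  toFun x := Multiplicative.ofAdd (x.1.b : ZMod l)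
  map_one' := by simp
  map_mul' x y := by
    have hx : (x.1.a : ZMod l) = 0 := (ZMod.intCast_zmod_eq_zero_iff_dvd x.1.a l).2 x.2
    simp [hx, ofAdd_add]

lemma abelianization_e13_ne_one {l : ℕ} (hl : l ≠ 1) : Abelianization.of (e13 l) ≠ 1 := by
  intro h
  have h1 : Abelianization.lift (Klev.bMod l) (Abelianization.of (e13 l)) = 1 := by
    rw [h, map_one]
  rw [Abelianization.lift_apply_of] at h1
  have h2 : ((1 : ℤ) : ZMod l) = 0 := h1
  rw [ZMod.intCast_zmod_eq_zero_iff_dvd] at h2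
  exact hl (Nat.dvd_one.1 (by exact_mod_cast h2))

lemma coe_e13_pow (l n : ℕ) : ((e13 l ^ n : Klev l) : Heis) = ⟨0, n, 0⟩ := by
  induction n with
  | zero => rfl
  | succ n ih =>
    rw [pow_succ, Subgroup.coe_mul, ih]
    ext <;> simp [e13]

lemma abelianization_e13_pow (l : ℕ) : Abelianization.of (e13 l) ^ l = 1 := by
  let x : Klev l := ⟨⟨l, 0, 0⟩, dvd_refl _⟩
  let y : Klev l := ⟨⟨0, 0, 1⟩, dvd_zero _⟩
  have h : x * y = y * x * e13 l ^ l := by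
    apply Subtype.ext
    rw [Subgroup.coe_mul, Subgroup.coe_mul, coe_e13_pow]
    ext <;> simp [x, y]
  have h' := congrArg Abelianization.of h
  rw [map_mul, map_mul, map_mul, map_pow, mul_comm (Abelianization.of x)] at h'
  exact left_eq_mul.1 h'

/-- For a prime `l`, the subgroup `K` of the integral Heisenberg group consisting of
matrices with `(1,2)`-entry divisible by `l` has index `l`, and its abelianization is
not torsion free: the class of the elementary matrix with `(1,3)`-entry `1` is a
nontrivial element whose order divides `l`. -/
theorem heisenberg_not_totally_torsion_free (l : ℕ) (hl : l.Prime) :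
    (Klev l).index = l ∧
    Abelianization.of (e13 l) ≠ 1 ∧
    (Abelianization.of (e13 l)) ^ l = 1 :=
  ⟨index_Klev l, abelianization_e13_ne_one hl.ne_one, abelianization_e13_pow l⟩
end
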